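/- For every integer k ≥ 4 and every field F, every PCR refutation over F of the formula TPHP has pigeon-degree at least ⌈(k−1)/2⌉, i.e., it contains a monomial mentioning at least ⌈(k−1)/2⌉ pigeons. -/

import Mathlib

namespace NarrowProofs

open MvPolynomial

/-- A clause is a finite set of literals; a literal is a variable together with a
sign (`true` = positive literal, `false` = negative literal). -/
abbrev Clause (V : Type) := Finset (V × Bool)

/-- PCR variables over the variable set `V`: `(v, false)` is the variable `v`
itself and `(v, true)` is its twin `v̄`. -/
abbrev PV (V : Type) := V × Bool

/-- The PCR encoding of a clause (truth is 0, falsity is 1): the clause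
`∨_{i∈I} x_i ∨ ∨_{j∈J} ¬x_j` becomes the monomial `∏_{i∈I} x_i · ∏_{j∈J} x̄_j`.
A positive literal `(v, true)` contributes the variable `(v, false)` and a
negative literal `(v, false)` contributes the twin `(v, true)`. -/
noncomputable def encodeClauseMono (K : Type) [CommRing K] {V : Type} [DecidableEq V]
    (C : Clause V) : MvPolynomial (PV V) K :=
  ∏ l ∈ C, X (l.1, !l.2)

/-- A PCR refutation over a field `K` of a CNF formula `F`: a sequence of
polynomials, each a Boolean axiom `x²−x`, a complementarity axiom `1−x−x̄`,
the encoding of a clause of `F`, a linear combination of two earlier lines, or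
a variable multiple of an earlier line, ending with the polynomial `1`. -/
structure PCRRefutation (K : Type) [Field K] (V : Type) [DecidableEq V]
    (F : Set (Clause V)) where
  lines : List (MvPolynomial (PV V) K)
  ne : lines ≠ []
  valid : ∀ (t : ℕ) (p : MvPolynomial (PV V) K), lines[t]? = some p →
    (∃ x : PV V, p = X x ^ 2 - X x) ∨
    (∃ v : V, p = 1 - X (v, false) - X (v, true)) ∨
    (∃ C ∈ F, p = encodeClauseMono K C) ∨
    (∃ i j : ℕ, i < t ∧ j < t ∧ ∃ (a b : K) (pi pj : MvPolynomial (PV V) K),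
      lines[i]? = some pi ∧ lines[j]? = some pj ∧ p = a • pi + b • pj) ∨
    (∃ i : ℕ, i < t ∧ ∃ (x : PV V) (pi : MvPolynomial (PV V) K),
      lines[i]? = some pi ∧ p = X x * pi)
  last_one : lines.getLast ne = 1

/-- The variables of the 3-CNF pigeonhole principle `TPHP`. -/
inductive TVar where
  | q (v w : ℕ)
  | z (v w : ℕ)
deriving DecidableEq

/-- The pigeon mentioned by a variable of `TPHP` (twins mention the same
pigeon). -/
def TVar.pigeon : TVar → ℕ
  | .q v _ => v
  | .z v _ => v

/-- The 3-CNF pigeonhole principle formula with `k` pigeons and `k-1` holes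
(1-based indices). -/
def TPHP (k : ℕ) : Set (Clause TVar) :=
  { C |
    (∃ v, 1 ≤ v ∧ v ≤ k ∧
      C = {(TVar.q v 1, true), (TVar.z v 1, true)}) ∨
    (∃ v w, 1 ≤ v ∧ v ≤ k ∧ 1 ≤ w ∧ w ≤ k - 4 ∧
      C = {(TVar.z v w, false), (TVar.q v (w+1), true), (TVar.z v (w+1), true)}) ∨
    (∃ v, 1 ≤ v ∧ v ≤ k ∧
      C = {(TVar.z v (k-3), false), (TVar.q v (k-2), true), (TVar.q v (k-1), true)}) ∨
    (∃ v v' w, 1 ≤ v ∧ v ≤ k ∧ 1 ≤ v' ∧ v' ≤ k ∧ v ≠ v' ∧ 1 ≤ w ∧ w ≤ k - 1 ∧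
      C = {(TVar.q v w, false), (TVar.q v' w, false)}) }

/-- The pigeon-degree of a monomial: the number of pigeons mentioned by its
variables. -/
def monoPigeonDegree (m : PV TVar →₀ ℕ) : ℕ :=
  (m.support.image (fun x => x.1.pigeon)).card

namespace Aux
open Finset Function

/-- the assigned pigeons of `f` are exactly those in `S` (hole `0` = unassigned) -/
def Dom (S : Finset ℕ) (f : ℕ → ℕ) : Prop := ∀ v, v ∈ S ↔ f v ≠ 0

/-- a matching with domain `S` inside the board `A` -/
def Valid (S : Finset ℕ) (A : ℕ → Finset ℕ) (f : ℕ → ℕ) : Prop :=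
  Dom S f ∧ (∀ v ∈ S, f v ∈ A v) ∧ (∀ v ∈ S, ∀ w ∈ S, f v = f w → v = w)

/-- Extension property of a board. -/
def Ext (K : Type) [Field K] (H S : Finset ℕ) (A : ℕ → Finset ℕ) : Prop :=
  ∀ ν : ℕ → (ℕ → ℕ) → K,
    (∀ u ∈ S, ∀ f, ν u f ≠ 0 → Valid (S.erase u) A f) →
    (∀ u ∈ S, ∀ u' ∈ S, u ≠ u' → ∀ f, Dom ((S.erase u).erase u') f →
      ∑ h ∈ H, ν u (update f u' h) = ∑ h ∈ H, ν u' (update f u h)) →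
    ∃ μ : (ℕ → ℕ) → K, (∀ f, μ f ≠ 0 → Valid S A f) ∧
      ∀ u ∈ S, ∀ f, Dom (S.erase u) f → ν u f = ∑ h ∈ H, μ (update f u h)

variable {K : Type} [Field K] {H : Finset ℕ}

lemma Dom.upd {S : Finset ℕ} {f : ℕ → ℕ} {u h : ℕ} (hf : Dom (S.erase u) f) (hu : u ∈ S)
    (hh : h ≠ 0) : Dom S (update f u h) := by
  intro v
  have := hf v
  by_cases hv : v = u
  · subst hv; simp [hu, hh]
  · simpa [hv] using this

lemma Dom.del {S : Finset ℕ} {f : ℕ → ℕ} {u : ℕ} (hf : Dom S f) :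
    Dom (S.erase u) (update f u 0) := by
  intro v
  have := hf v
  by_cases hv : v = u
  · subst hv; simp
  · simpa [hv] using this

lemma Dom.unique {S T : Finset ℕ} {f : ℕ → ℕ} (h1 : Dom S f) (h2 : Dom T f) : S = T := by
  ext v; rw [h1 v, h2 v]

lemma ext_cone (H0 : 0 ∉ H) (S : Finset ℕ) (A : ℕ → Finset ℕ) (p h0 : ℕ) (hp : p ∈ S)
    (hh0 : h0 ∈ H) (hA : A p = {h0}) (hq : ∀ q ∈ S, q ≠ p → h0 ∉ A q) : Ext K H S A := by
  classical
  intro ν hν hc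
  have h00 : h0 ≠ 0 := fun h => H0 (h ▸ hh0)
  have key : ∀ f, Valid (S.erase p) A f → Valid S A (update f p h0) := by
    rintro f ⟨h1, h2, h3⟩
    refine ⟨h1.upd hp h00, ?_, ?_⟩
    · intro v hv
      by_cases hvp : v = p
      · subst hvp; simp [hA]
      · simpa [hvp] using h2 v (by simp [hvp, hv])
    · intro v hv w hw
      by_cases hvp : v = p <;> by_cases hwp : w = p
      · simp [hvp, hwp]
      · subst hvp; simp [hwp]
        intro h; exact absurd (h2 w (by simp [hwp, hw])) (h ▸ hq w hw hwp)
      · subst hwp; simp [hvp]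
        intro h; exact absurd (h2 v (by simp [hvp, hv])) (h ▸ hq v hv hvp)
      · simpa [hvp, hwp] using h3 v (by simp [hvp, hv]) w (by simp [hwp, hw])
  refine ⟨fun f => if Valid S A f then ν p (update f p 0) else 0, ?_, ?_⟩
  · intro f hf
    by_contra h
    simp [h] at hf
  intro u hu f hf
  by_cases hup : u = p
  · subst hup
    have hfu : f u = 0 := by
      by_contra h; have := (hf u).2 h; simp at this
    have e : ∀ h, update (update f u h) u 0 = f := by
      intro h; ext v; by_cases hv : v = u
      · subst hv; simp [hfu]
      · simp [hv]
    simp only [e]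
    rw [Finset.sum_eq_single h0]
    · split_ifs with hv
      · rfl
      · by_contra h; exact hv (key f (hν u hu f h))
    · intro b hb hb0
      rw [if_neg]
      rintro ⟨_, h2, _⟩
      have := h2 u hu
      simp [hA] at this; exact hb0 this
    · intro h; exact absurd hh0 h
  · by_cases hfp : f p = h0
    · set g := update f p 0 with hg
      have hgd : Dom ((S.erase p).erase u) g := by
        rw [Finset.erase_right_comm]; exact hf.del
      have hgf : update g p h0 = f := by
        ext v; by_cases hv : v = p
        · subst hv; simp [hfp]
        · simp [hg, hv]
      have hfu : ∀ h, update (update f u h) p 0 = update g u h := by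
        intro h; rw [hg, update_comm hup]
      have hfu' : ∀ h, update f u h = update (update g u h) p h0 := by
        intro h; rw [update_comm hup, hgf]
      have : ∀ h ∈ H, (if Valid S A (update f u h) then ν p (update (update f u h) p 0) else 0)
          = ν p (update g u h) := by
        intro h hh
        rw [hfu]
        split_ifs with hv
        · rfl
        · by_contra h'
          apply hv; rw [hfu']
          exact key _ (hν p hp _ (Ne.symm h'))
      rw [Finset.sum_congr rfl this, hc p hp u hu (Ne.symm hup) g hgd, Finset.sum_eq_single h0, hgf]
      · intro b hb hb0
        by_contra h'
        have := (hν u hu _ h').2.1 p (by simp [hp, Ne.symm hup])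
        simp [hA] at this; exact hb0 this
      · intro h; exact absurd hh0 h
    · have h1 : ν u f = 0 := by
        by_contra h'
        have := (hν u hu _ h').2.1 p (by simp [hp, Ne.symm hup])
        simp [hA] at this; exact hfp this
      rw [h1, Finset.sum_eq_zero]
      intro h hh
      beta_reduce
      rw [if_neg]
      rintro ⟨_, h2, _⟩
      have := h2 p hp
      simp [hA, Ne.symm hup] at this; exact hfp this

lemma Valid.ofL {S : Finset ℕ} {A : ℕ → Finset ℕ} {q h0 : ℕ} {f : ℕ → ℕ} (hq : q ∈ S)
    (h00 : h0 ≠ 0) (hA : h0 ∈ A q)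
    (hf : Valid (S.erase q) (fun v => (A v).erase h0) f) : Valid S A (update f q h0) := by
  obtain ⟨h1, h2, h3⟩ := hf
  refine ⟨h1.upd hq h00, ?_, ?_⟩
  · intro v hv
    by_cases hvp : v = q
    · subst hvp; simpa using hA
    · have := h2 v (by simp [hvp, hv])
      simp at this
      simpa [hvp] using this.2
  · intro v hv w hw
    by_cases hvp : v = q <;> by_cases hwp : w = q
    · simp [hvp, hwp]
    · subst hvp; simp [hwp]
      intro h
      have := h2 w (by simp [hwp, hw])
      simp [h] at this
    · subst hwp; simp [hvp]
      intro h
      have := h2 v (by simp [hvp, hv])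
      simp [h] at this
    · simpa [hvp, hwp] using h3 v (by simp [hvp, hv]) w (by simp [hwp, hw])

lemma Valid.toL {S : Finset ℕ} {A : ℕ → Finset ℕ} {q h0 : ℕ} {f : ℕ → ℕ} (hq : q ∈ S)
    (hfq : f q = h0)
    (hf : Valid S A f) : Valid (S.erase q) (fun v => (A v).erase h0) (update f q 0) := by
  obtain ⟨h1, h2, h3⟩ := hf
  refine ⟨h1.del, ?_, ?_⟩
  · intro v hv
    simp at hv
    simp only [mem_erase]
    refine ⟨?_, ?_⟩
    · rw [update_of_ne hv.1]
      intro h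
      exact hv.1 (h3 v hv.2 q hq (by rw [h, hfq]))
    · rw [update_of_ne hv.1]; exact h2 v hv.2
  · intro v hv w hw
    simp at hv hw
    rw [update_of_ne hv.1, update_of_ne hw.1]
    exact h3 v hv.2 w hw.2

lemma Valid.mono {S : Finset ℕ} {A B : ℕ → Finset ℕ} {f : ℕ → ℕ} (h : ∀ v ∈ S, A v ⊆ B v)
    (hf : Valid S A f) : Valid S B f :=
  ⟨hf.1, fun v hv => h v hv (hf.2.1 v hv), hf.2.2⟩

lemma ext_add (H0 : 0 ∉ H) (S : Finset ℕ) (A : ℕ → Finset ℕ) (q h0 : ℕ) (hq : q ∈ S)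
    (hh0 : h0 ∈ H) (hA : h0 ∈ A q) (E1 : Ext K H S (update A q ((A q).erase h0)))
    (E2 : Ext K H (S.erase q) (fun v => (A v).erase h0)) : Ext K H S A := by
  classical
  intro ν hν hc
  have h00 : h0 ≠ 0 := fun h => H0 (h ▸ hh0)
  set B := update A q ((A q).erase h0) with hB
  have hBA : ∀ v, B v ⊆ A v := by
    intro v; by_cases hv : v = q
    · subst hv; simp [hB, Finset.erase_subset]
    · simp [hB, hv]
  obtain ⟨μx, hμx, hmx⟩ := E2
    (fun u f => if Dom ((S.erase q).erase u) f then ν u (update f q h0) else 0) (by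
      intro u hu f hf
      simp at hu
      simp only [ne_eq, ite_eq_right_iff, Classical.not_imp] at hf
      have := (hν u hu.2 _ hf.2).toL (q := q) (h0 := h0) (by simp [hq, Ne.symm hu.1]) (by simp)
      rw [Finset.erase_right_comm]
      have e : update (update f q h0) q 0 = f := by
        ext v; by_cases hv : v = q
        · subst hv
          have := hf.1 v
          simp at this; simp [this]
        · simp [hv]
      rwa [e] at this) (by
      intro u hu u' hu' huu f hf
      simp at hu hu'
      have e1 : ∀ h ∈ H, Dom ((S.erase q).erase u) (update f u' h) := by
        intro h hh
        exact hf.upd (by simp [huu.symm, hu']) (fun h' => H0 (h' ▸ hh))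
      have e2 : ∀ h ∈ H, Dom ((S.erase q).erase u') (update f u h) := by
        intro h hh
        rw [Finset.erase_right_comm] at hf
        exact hf.upd (by simp [huu, hu]) (fun h' => H0 (h' ▸ hh))
      rw [Finset.sum_congr rfl (fun h hh => if_pos (e1 h hh)),
        Finset.sum_congr rfl (fun h hh => if_pos (e2 h hh))]
      have := hc u hu.2 u' hu'.2 huu (update f q h0) (by
        apply Dom.upd (S := (S.erase u).erase u') _ (by simp [hq, Ne.symm hu.1, Ne.symm hu'.1]) h00
        convert hf using 1
        ext v; simp; tauto)
      simpa only [update_comm hu.1, update_comm hu'.1] using this)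
  -- the reduced data
  have hμL : ∀ f, μx f ≠ 0 → Valid (S.erase q) B f := by
    intro f hf
    refine (hμx f hf).mono ?_
    intro v hv
    simp at hv
    simp [hB, hv.1, Finset.erase_subset]
  obtain ⟨μ', hμ', hm'⟩ := E1
    (fun u f => if u = q then ν q f - μx f else if f q = h0 then 0 else ν u f) (by
      intro u hu f hf
      by_cases huq : u = q
      · subst huq
        simp only [if_true] at hf
        by_cases h1 : μx f = 0
        · rw [h1, sub_zero] at hf
          refine (hν u hu f hf).mono ?_
          intro v hv; simp at hv; simp [hB, hv.1]
        · exact hμL f h1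
      · simp only [huq, if_false, ne_eq, ite_eq_left_iff, Classical.not_imp] at hf
        obtain ⟨h1, h2, h3⟩ := hν u hu f hf.2
        refine ⟨h1, ?_, h3⟩
        intro v hv
        by_cases hvq : v = q
        · subst hvq; simp [hB, hf.1, h2 v hv]
        · simpa [hB, hvq] using h2 v hv) (by
      have main : ∀ u ∈ S, u ≠ q → ∀ f, Dom ((S.erase q).erase u) f →
          ∑ h ∈ H, (ν q (update f u h) - μx (update f u h)) =
          ∑ h ∈ H, (if (update f q h) q = h0 then 0 else ν u (update f q h)) := by
        intro u hu huq f hf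
        rw [Finset.sum_sub_distrib, hc q hq u hu (Ne.symm huq) f hf,
          ← hmx u (by simp [hu, huq]) f hf, if_pos hf]
        rw [← Finset.add_sum_erase _ _ hh0, ← Finset.add_sum_erase (a := h0) (s := H)
          (f := fun h => (if (update f q h) q = h0 then 0 else ν u (update f q h))) hh0]
        simp only [update_self, if_true, zero_add, add_sub_cancel_left]
        apply Finset.sum_congr rfl
        intro h hh
        simp at hh; simp [hh.1]
      intro u hu u' hu' huu f hf
      by_cases huq : u = q
      · subst huq
        simp only [if_true, if_neg huu.symm]
        exact main u' hu' huu.symm f hf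
      · by_cases huq' : u' = q
        · subst huq'
          simp only [if_true, if_neg huq]
          rw [Finset.erase_right_comm] at hf
          exact (main u hu huq f hf).symm
        · simp only [huq, huq', if_false, update_of_ne (Ne.symm huq), update_of_ne (Ne.symm huq')]
          by_cases hfq : f q = h0
          · simp [hfq]
          · simp only [hfq, if_false]
            exact hc u hu u' hu' huu f hf)
  refine ⟨fun f => if f q = h0 then μx (update f q 0) else μ' f, ?_, ?_⟩
  · intro f hf
    by_cases hfq : f q = h0
    · simp only [hfq, if_true] at hf
      have := (hμx _ hf).ofL hq h00 hA
      rwa [update_idem, ← hfq, update_eq_self] at this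
    · simp only [hfq, if_false] at hf
      exact (hμ' f hf).mono (fun v _ => hBA v)
  · intro u hu f hf
    have hm := hm' u hu f hf
    have hz : ∀ f, f q = h0 → μ' f = 0 := by
      intro f hf
      by_contra h
      have := (hμ' f h).2.1 q hq
      simp [hB, hf] at this
    by_cases huq : u = q
    · subst huq
      simp only [if_true, update_self] at hm ⊢
      rw [← Finset.add_sum_erase _ _ hh0] at hm ⊢
      rw [hz _ (by simp), zero_add] at hm
      have e : update (update f u h0) u 0 = f := by
        ext v; by_cases hv : v = u
        · subst hv
          have := hf v
          simp at this; simp [this]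
        · simp [hv]
      rw [if_pos rfl, e, ← sub_eq_iff_eq_add', hm]
      apply Finset.sum_congr rfl
      intro h hh
      simp at hh; simp [hh.1]
    · simp only [huq, if_false, update_of_ne (Ne.symm huq)] at hm ⊢
      by_cases hfq : f q = h0
      · simp only [hfq, if_true] at hm ⊢
        have hd : Dom ((S.erase q).erase u) (update f q 0) := by
          rw [Finset.erase_right_comm]; exact hf.del
        have := hmx u (by simp [hu, huq]) (update f q 0) hd
        rw [if_pos hd, update_idem, ← hfq, update_eq_self] at this
        rw [this]
        apply Finset.sum_congr rfl
        intro h hh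
        rw [update_comm huq]
      · simp only [hfq, if_false] at hm ⊢
        exact hm

lemma ext_step (H0 : 0 ∉ H) (s : ℕ)
    (IH : ∀ S : Finset ℕ, S.card = s → ∀ A : ℕ → Finset ℕ, (∀ v ∈ S, A v ⊆ H) →
      (∀ v ∈ S, 2 * s - 1 ≤ (A v).card) → Ext K H S A)
    (S : Finset ℕ) (hS : S.card = s + 1) (p h0 : ℕ) (hp : p ∈ S) (N : ℕ) :
    ∀ A : ℕ → Finset ℕ, ∑ v ∈ S, (A v).card = N → (∀ v ∈ S, A v ⊆ H) → h0 ∈ A p →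
      (∀ v ∈ S, v ≠ p → 2 * s ≤ ((A v).erase h0).card) →
      ((∃ v ∈ S, v ≠ p ∧ h0 ∈ A v) → 2 * s + 1 ≤ (A p).card) → Ext K H S A := by
  induction N using Nat.strong_induction_on with
  | _ N ihN =>
  intro A hN hAH hA0 hAq hAp
  have hlt : ∀ q ∈ S, ∀ h ∈ A q, ∑ v ∈ S, (update A q ((A q).erase h) v).card < N := by
    intro q hq h hh
    rw [← hN]
    apply Finset.sum_lt_sum
    · intro v hv
      by_cases hvq : v = q
      · subst hvq; simpa using Finset.card_le_card (Finset.erase_subset _ _)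
      · simp [hvq]
    · exact ⟨q, hq, by simpa using Finset.card_erase_lt_of_mem hh⟩
  have hsub : ∀ q ∈ S, ∀ h ∈ A q, ∀ v ∈ S, update A q ((A q).erase h) v ⊆ H := by
    intro q hq h hh v hv
    by_cases hvq : v = q
    · subst hvq; simpa using (Finset.erase_subset _ _).trans (hAH v hv)
    · simpa [hvq] using hAH v hv
  by_cases c1 : ∃ v ∈ S, v ≠ p ∧ h0 ∈ A v
  · obtain ⟨q, hq, hqp, hq0⟩ := c1
    have hApc := hAp ⟨q, hq, hqp, hq0⟩
    apply ext_add H0 S A q h0 hq (hAH q hq hq0) hq0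
    · apply ihN _ (hlt q hq h0 hq0) _ rfl (hsub q hq h0 hq0)
      · simpa [Ne.symm hqp] using hA0
      · intro v hv hvp
        by_cases hvq : v = q
        · subst hvq; simpa using hAq v hv hvp
        · simpa [hvq] using hAq v hv hvp
      · intro _; simpa [Ne.symm hqp] using hApc
    · apply IH _ (by rw [Finset.card_erase_of_mem hq, hS]; rfl)
      · intro v hv; simp at hv
        exact (Finset.erase_subset _ _).trans (hAH v hv.2)
      · intro v hv; simp at hv
        by_cases hvp : v = p
        · subst hvp
          rw [Finset.card_erase_of_mem hA0]; omega
        · have := hAq v hv.2 hvp; omega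
  · push Not at c1
    by_cases c2 : ∃ h ∈ A p, h ≠ h0
    · obtain ⟨h, hh, hne⟩ := c2
      apply ext_add H0 S A p h hp (hAH p hp hh) hh
      · apply ihN _ (hlt p hp h hh) _ rfl (hsub p hp h hh)
        · simp [Ne.symm hne, hA0]
        · intro v hv hvp
          simpa [hvp] using hAq v hv hvp
        · rintro ⟨v, hv, hvp, hv0⟩
          simp [hvp] at hv0
          exact absurd hv0 (c1 v hv hvp)
      · apply IH _ (by rw [Finset.card_erase_of_mem hp, hS]; rfl)
        · intro v hv; simp at hv
          exact (Finset.erase_subset _ _).trans (hAH v hv.2)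
        · intro v hv; simp at hv
          have h1 := hAq v hv.2 hv.1
          rw [Finset.erase_eq_of_notMem (c1 v hv.2 hv.1)] at h1
          have := Finset.pred_card_le_card_erase (s := A v) (a := h)
          omega
    · push Not at c2
      apply ext_cone H0 S A p h0 hp (hAH p hp hA0)
      · ext x; simp; exact ⟨c2 x, fun h => h ▸ hA0⟩
      · exact c1

lemma ext_all (H0 : 0 ∉ H) (s : ℕ) :
    ∀ S : Finset ℕ, S.card = s → ∀ A : ℕ → Finset ℕ, (∀ v ∈ S, A v ⊆ H) →
      (∀ v ∈ S, 2 * s - 1 ≤ (A v).card) → Ext K H S A := by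
  induction s with
  | zero =>
    intro S hS A _ _ ν _ _
    rw [Finset.card_eq_zero] at hS
    subst hS
    exact ⟨fun _ => 0, by simp, by simp⟩
  | succ s ih =>
    intro S hS A hAH hA
    obtain ⟨p, hp⟩ : S.Nonempty := by rw [← Finset.card_pos]; omega
    obtain ⟨h0, hh0⟩ : (A p).Nonempty := by
      rw [← Finset.card_pos]; have := hA p hp; omega
    apply ext_step H0 s ih S hS p h0 hp _ A rfl hAH hh0
    · intro v hv _
      have := hA v hv
      have := Finset.pred_card_le_card_erase (s := A v) (a := h0)
      omega
    · intro _; have := hA p hp; omega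

/-- `f` is a partial matching into `H`. -/
def Val (H : Finset ℕ) (f : ℕ → ℕ) : Prop :=
  (∀ v, f v ≠ 0 → f v ∈ H) ∧ (∀ v w, f v ≠ 0 → f v = f w → v = w)

def Cons (H : Finset ℕ) (μ : (ℕ → ℕ) → K) (S : Finset ℕ) : Prop :=
  ∀ u ∈ S, ∀ f, Dom (S.erase u) f → μ f = ∑ h ∈ H, μ (update f u h)

lemma ext_level (H0 : 0 ∉ H) (r : ℕ) (hr : 2 * r - 1 ≤ H.card) (μ0 : (ℕ → ℕ) → K)
    (hv : ∀ f, μ0 f ≠ 0 → Val H f) (hc : ∀ S : Finset ℕ, S.card < r → Cons H μ0 S) :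
    ∃ μ : (ℕ → ℕ) → K, (∀ f, μ f ≠ 0 → Val H f) ∧ (∀ S : Finset ℕ, S.card ≤ r → Cons H μ S) ∧
      (∀ S f, Dom S f → (S.card ≠ r ∨ Cons H μ0 S) → μ f = μ0 f) := by
  classical
  have step : ∀ S : Finset ℕ, ∃ m : (ℕ → ℕ) → K, S.card = r →
      (∀ f, m f ≠ 0 → Val H f) ∧
      (∀ u ∈ S, ∀ f, Dom (S.erase u) f → μ0 f = ∑ h ∈ H, m (update f u h)) ∧
      (Cons H μ0 S → m = μ0) := by
    intro S
    by_cases hS : S.card = r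
    · by_cases hcS : Cons H μ0 S
      · exact ⟨μ0, fun _ => ⟨hv, hcS, fun _ => rfl⟩⟩
      · have hE : Ext K H S (fun _ => H) :=
          ext_all H0 r S hS (fun _ => H) (fun _ _ => subset_rfl) (fun _ _ => hr)
        obtain ⟨m, hm1, hm2⟩ := hE (fun u f => if Dom (S.erase u) f then μ0 f else 0) (by
          intro u hu f hf
          simp only [ne_eq, ite_eq_right_iff, Classical.not_imp] at hf
          have := hv f hf.2
          exact ⟨hf.1, fun v hv => this.1 v ((hf.1 v).1 hv),
            fun v hv w _ h => this.2 v w ((hf.1 v).1 hv) h⟩) (by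
          intro u hu u' hu' huu f hf
          have hf' := hf
          rw [Finset.erase_right_comm] at hf'
          rw [Finset.sum_congr rfl (fun h hh => if_pos (hf.upd (by simp [huu.symm, hu'])
              (fun h' => H0 (h' ▸ hh)))),
            Finset.sum_congr rfl (fun h hh => if_pos (hf'.upd (by simp [huu, hu])
              (fun h' => H0 (h' ▸ hh))))]
          rw [← hc (S.erase u) (by rw [← hS]; exact Finset.card_erase_lt_of_mem hu) u'
              (by simp [huu.symm, hu']) f hf,
            ← hc (S.erase u') (by rw [← hS]; exact Finset.card_erase_lt_of_mem hu') u
              (by simp [huu, hu]) f hf'])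
        refine ⟨m, fun _ => ⟨?_, ?_, fun h => absurd h hcS⟩⟩
        · intro f hf
          obtain ⟨h1, h2, h3⟩ := hm1 f hf
          refine ⟨fun v hv => h2 v ((h1 v).2 hv), fun v w hv h => ?_⟩
          exact h3 v ((h1 v).2 hv) w ((h1 w).2 (h ▸ hv)) h
        · intro u hu f hf
          rw [← hm2 u hu f hf, if_pos hf]
    · exact ⟨0, fun h => absurd h hS⟩
  choose F hF using step
  let μ : (ℕ → ℕ) → K := fun f =>
    if h : ∃ S : Finset ℕ, S.card = r ∧ Dom S f then F h.choose f else μ0 f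
  have e1 : ∀ S f, S.card = r → Dom S f → μ f = F S f := by
    intro S f hS hf
    have h : ∃ S : Finset ℕ, S.card = r ∧ Dom S f := ⟨S, hS, hf⟩
    simp only [μ, dif_pos h]
    rw [h.choose_spec.2.unique hf]
  have e2 : ∀ S f, S.card ≠ r → Dom S f → μ f = μ0 f := by
    intro S f hS hf
    have h : ¬ ∃ S : Finset ℕ, S.card = r ∧ Dom S f := by
      rintro ⟨T, hT, hd⟩
      exact hS (hf.unique hd ▸ hT)
    simp only [μ, dif_neg h]
  refine ⟨μ, ?_, ?_, ?_⟩
  · intro f hf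
    by_cases h : ∃ S : Finset ℕ, S.card = r ∧ Dom S f
    · obtain ⟨S, hS, hd⟩ := h
      rw [e1 S f hS hd] at hf
      exact (hF S hS).1 f hf
    · simp only [μ, dif_neg h] at hf
      exact hv f hf
  · intro S hS u hu f hf
    have hlt := Finset.card_erase_lt_of_mem hu
    rw [e2 _ f (by omega) hf]
    rcases hS.lt_or_eq with h | h
    · rw [hc S h u hu f hf]
      refine Finset.sum_congr rfl fun x hx => ?_
      rw [e2 S _ (by omega) (hf.upd hu fun h' => H0 (h' ▸ hx))]
    · rw [(hF S h).2.1 u hu f hf]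
      refine Finset.sum_congr rfl fun x hx => ?_
      rw [e1 S _ h (hf.upd hu fun h' => H0 (h' ▸ hx))]
  · intro S f hf h
    by_cases hS : S.card = r
    · rw [e1 S f hS hf, (hF S hS).2.2 (h.resolve_left (not_not.2 hS))]
    · exact e2 S f hS hf

lemma exists_cons (K : Type) [Field K] (H : Finset ℕ) (H0 : 0 ∉ H) (r : ℕ)
    (hr : 2 * r - 1 ≤ H.card) :
    ∃ μ : (ℕ → ℕ) → K, (∀ f, μ f ≠ 0 → Val H f) ∧ (∀ S : Finset ℕ, S.card ≤ r → Cons H μ S) ∧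
      μ 0 = 1 := by
  classical
  induction r with
  | zero =>
    refine ⟨fun f => if f = 0 then 1 else 0, ?_, ?_, by simp⟩
    · intro f hf
      have : f = 0 := by by_contra h; simp [h] at hf
      subst this
      exact ⟨by simp, by simp⟩
    · intro S hS u hu
      simp at hS; subst hS; simp at hu
  | succ r ih =>
    obtain ⟨μ, h1, h2, h3⟩ := ih (by omega)
    obtain ⟨μ', g1, g2, g3⟩ := ext_level H0 (r + 1) hr μ h1 (fun S hS => h2 S (by omega))
    refine ⟨μ', g1, g2, ?_⟩
    rw [g3 ∅ 0 (by intro v; simp) (Or.inl (by simp)), h3]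

/-- Multiplication by a function `x` of the hole of pigeon `v`. -/
lemma mul_cons (H0 : 0 ∉ H) (r : ℕ) (hr : 2 * r - 1 ≤ H.card) (μ : (ℕ → ℕ) → K)
    (hv : ∀ f, μ f ≠ 0 → Val H f) (hc : ∀ S : Finset ℕ, S.card ≤ r → Cons H μ S)
    (v : ℕ) (x : ℕ → K) :
    ∃ μ' : (ℕ → ℕ) → K, (∀ f, μ' f ≠ 0 → Val H f) ∧
      (∀ S : Finset ℕ, S.card ≤ r → Cons H μ' S) ∧
      (∀ S f, Dom S f → v ∈ S → S.card ≤ r → μ' f = x (f v) * μ f) ∧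
      (∀ S f, Dom S f → v ∉ S → S.card < r →
        μ' f = ∑ h ∈ H, x h * μ (update f v h)) := by
  classical
  let μ0 : (ℕ → ℕ) → K := fun f =>
    if f v = 0 then ∑ h ∈ H, x h * μ (update f v h) else x (f v) * μ f
  have c1 : ∀ S : Finset ℕ, v ∈ S → S.card ≤ r → Cons H μ0 S := by
    intro S hvS hS u hu f hf
    by_cases huv : u = v
    · subst huv
      have hfu : f u = 0 := by
        by_contra h; have := (hf u).2 h; simp at this
      simp only [μ0, if_pos hfu]
      refine Finset.sum_congr rfl fun h hh => ?_
      have hne : h ≠ 0 := fun h' => H0 (h' ▸ hh)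
      rw [update_self, if_neg hne]
    · have hfv : f v ≠ 0 := (hf v).1 (by simp [hvS, Ne.symm huv])
      simp only [μ0, if_neg hfv, update_of_ne (Ne.symm huv)]
      rw [← Finset.mul_sum, ← hc S hS u hu f hf]
  have c2 : ∀ S : Finset ℕ, S.card < r → Cons H μ0 S := by
    intro S hS
    by_cases hvS : v ∈ S
    · exact c1 S hvS hS.le
    · intro u hu f hf
      have huv : u ≠ v := fun h => hvS (h ▸ hu)
      have hfv : f v = 0 := by
        by_contra h; have := (hf v).2 h; simp at this; exact hvS this.2
      simp only [μ0, if_pos hfv, update_of_ne huv.symm]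
      rw [Finset.sum_comm]
      refine Finset.sum_congr rfl fun h hh => ?_
      rw [← Finset.mul_sum, hc (insert v S) (by rw [Finset.card_insert_of_notMem hvS]; omega) u
        (by simp [hu]) (update f v h)]
      · simp only [update_comm huv]
      · apply Dom.upd _ (by simp [huv.symm]) (fun h' => H0 (h' ▸ hh))
        convert hf using 1
        ext w; simp
        constructor
        · rintro ⟨h1, h2, h3⟩; tauto
        · rintro ⟨h1, h2⟩; exact ⟨fun h3 => hvS (h3 ▸ h2), h1, Or.inr h2⟩
  obtain ⟨μ', g1, g2, g3⟩ := ext_level H0 r hr μ0 (by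
    intro f hf
    by_cases hfv : f v = 0
    · simp only [μ0, if_pos hfv] at hf
      obtain ⟨h, hh, hne⟩ := Finset.exists_ne_zero_of_sum_ne_zero hf
      obtain ⟨a1, a2⟩ := hv _ (right_ne_zero_of_mul hne)
      refine ⟨?_, ?_⟩
      · intro w hw
        have hwv : w ≠ v := fun h => hw (h ▸ hfv)
        have := a1 w
        rw [update_of_ne hwv] at this
        exact this hw
      · intro w w' hw hww
        have hwv : w ≠ v := fun h => hw (h ▸ hfv)
        have hwv' : w' ≠ v := fun h => hw (hww.trans (h ▸ hfv))
        have := a2 w w'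
        rw [update_of_ne hwv, update_of_ne hwv'] at this
        exact this hw hww
    · simp only [μ0, if_neg hfv] at hf
      exact hv f (right_ne_zero_of_mul hf)) c2
  refine ⟨μ', g1, g2, ?_, ?_⟩
  · intro S f hf hvS hS
    rw [g3 S f hf (Or.inr (c1 S hvS hS))]
    simp only [μ0, if_neg ((hf v).1 hvS)]
  · intro S f hf hvS hS
    rw [g3 S f hf (Or.inl hS.ne)]
    have : f v = 0 := by by_contra h; exact hvS ((hf v).2 h)
    simp only [μ0, if_pos this]

/-- integration of `g` over the matchings with domain `T` -/
noncomputable def EE (H : Finset ℕ) (μ : (ℕ → ℕ) → K) (T : Finset ℕ) (g : (ℕ → ℕ) → K) : K :=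
  ∑ f ∈ T.finsupp (fun _ => H), μ (f : ℕ → ℕ) * g (f : ℕ → ℕ)

lemma dom_of_mem (H0 : 0 ∉ H) {T : Finset ℕ} {f : ℕ →₀ ℕ} (hf : f ∈ T.finsupp (fun _ => H)) :
    Dom T f := by
  rw [Finset.mem_finsupp_iff] at hf
  intro v
  constructor
  · intro hv h
    exact H0 (h ▸ hf.2 v hv)
  · intro h
    exact hf.1 (by simpa using h)

lemma sum_insert_finsupp (H0 : 0 ∉ H) {T : Finset ℕ} {v : ℕ} (hvT : v ∉ T) (G : (ℕ → ℕ) → K) :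
    ∑ f ∈ (insert v T).finsupp (fun _ => H), G (f : ℕ → ℕ) =
      ∑ f ∈ T.finsupp (fun _ => H), ∑ h ∈ H, G (update (f : ℕ → ℕ) v h) := by
  classical
  rw [← Finset.sum_product']
  refine Finset.sum_bij' (fun f _ => (f.update v 0, f v)) (fun a _ => a.1.update v a.2) ?_ ?_ ?_ ?_ ?_
  · intro f hf
    have hd := dom_of_mem H0 hf
    rw [Finset.mem_finsupp_iff] at hf
    rw [Finset.mem_product, Finset.mem_finsupp_iff]
    refine ⟨⟨?_, ?_⟩, hf.2 v (by simp)⟩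
    · intro w hw
      by_cases hwv : w = v
      · subst hwv; simp at hw
      · simp [hwv] at hw
        simpa [hwv] using (hd w).2 hw
    · intro w hw
      have hwv : w ≠ v := fun h => hvT (h ▸ hw)
      simpa [hwv] using hf.2 w (by simp [hw])
  · rintro ⟨f, h⟩ hf
    rw [Finset.mem_product] at hf
    have hd := dom_of_mem H0 hf.1
    rw [Finset.mem_finsupp_iff] at hf ⊢
    refine ⟨?_, ?_⟩
    · intro w hw
      by_cases hwv : w = v
      · simp [hwv]
      · simp [hwv] at hw
        simpa [hwv] using (hd w).2 hw
    · intro w hw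
      by_cases hwv : w = v
      · subst hwv; simpa using hf.2
      · simp [hwv] at hw
        simpa [hwv] using hf.1.2 w hw
  · intro f hf
    ext w
    by_cases hwv : w = v
    · simp [hwv]
    · simp [hwv]
  · rintro ⟨f, h⟩ hf
    rw [Finset.mem_product] at hf
    have hd := dom_of_mem H0 hf.1
    have hfv : f v = 0 := by by_contra h; exact hvT ((hd v).2 h)
    ext w
    · by_cases hwv : w = v
      · simp [hwv, hfv]
      · simp [hwv]
    · simp
  · intro f hf
    congr 1
    ext w
    by_cases hwv : w = v
    · simp [hwv]
    · simp [hwv]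

lemma EE_insert (H0 : 0 ∉ H) {μ : (ℕ → ℕ) → K} {T : Finset ℕ} {v : ℕ} (hvT : v ∉ T)
    (hc : Cons H μ (insert v T)) (g : (ℕ → ℕ) → K)
    (hg : ∀ f h, g (update f v h) = g f) : EE H μ (insert v T) g = EE H μ T g := by
  unfold EE
  rw [sum_insert_finsupp H0 hvT (fun f => μ f * g f)]
  refine Finset.sum_congr rfl fun f hf => ?_
  simp only [hg]
  rw [← Finset.sum_mul, ← hc v (by simp) f]
  rw [Finset.erase_insert hvT]
  exact dom_of_mem H0 hf

/-- truth assignment (truth is `0`) attached to a matching -/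
def base (K : Type) [Field K] (f : ℕ → ℕ) : TVar → K
  | .q v w => if f v = w then 0 else 1
  | .z v w => if w < f v then 0 else 1

def pt (K : Type) [Field K] (f : ℕ → ℕ) (x : PV TVar) : K :=
  if x.2 = true then 1 - base K f x.1 else base K f x.1

/-- value of a variable as a function of the hole of its pigeon -/
def loc (K : Type) [Field K] (x : PV TVar) (h : ℕ) : K := pt K (fun _ => h) x

lemma pt_eq (f : ℕ → ℕ) (x : PV TVar) : pt K f x = loc K x (f x.1.pigeon) := by
  obtain ⟨x, b⟩ := x
  cases x <;> rfl

lemma pt_sq (f : ℕ → ℕ) (x : PV TVar) : pt K f x ^ 2 = pt K f x := by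
  obtain ⟨x, b⟩ := x
  cases x <;> simp only [pt, base] <;> split_ifs <;> simp

def pig (m : PV TVar →₀ ℕ) : Finset ℕ := m.support.image (fun x => x.1.pigeon)

def val (K : Type) [Field K] (m : PV TVar →₀ ℕ) (f : ℕ → ℕ) : K :=
  m.prod fun x e => pt K f x ^ e

noncomputable def LL (H : Finset ℕ) (μ : (ℕ → ℕ) → K) : MvPolynomial (PV TVar) K →ₗ[K] K :=
  (basisMonomials (PV TVar) K).constr K (fun m => EE H μ (pig m) (val K m))

lemma LL_monomial (H : Finset ℕ) (μ : (ℕ → ℕ) → K) (m : PV TVar →₀ ℕ) (a : K) :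
    LL H μ (monomial m a) = a * EE H μ (pig m) (val K m) := by
  have : monomial m a = a • basisMonomials (PV TVar) K m := by
    simp [coe_basisMonomials, smul_monomial]
  rw [this, map_smul, LL, Module.Basis.constr_basis, smul_eq_mul]

lemma finsupp_empty (H : Finset ℕ) : (∅ : Finset ℕ).finsupp (fun _ => H) = {0} := by
  ext f
  simp [Finset.mem_finsupp_iff]

lemma LL_one (H : Finset ℕ) (μ : (ℕ → ℕ) → K) : LL H μ 1 = μ 0 := by
  have : (1 : MvPolynomial (PV TVar) K) = monomial 0 1 := rfl
  rw [this, LL_monomial]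
  simp [EE, pig, val, finsupp_empty]

lemma LL_X (H : Finset ℕ) (μ : (ℕ → ℕ) → K) (x : PV TVar) :
    LL H μ (X x) = EE H μ {x.1.pigeon} (fun f => pt K f x) := by
  have : (X x : MvPolynomial (PV TVar) K) = monomial (Finsupp.single x 1) 1 := rfl
  rw [this, LL_monomial]
  have h2 : val K (Finsupp.single x 1) = fun f => pt K f x := by
    ext f; simp [val]
  rw [h2, pig, (Finsupp.support_single (a := x) (b := 1) one_ne_zero)]
  simp

lemma LL_bool (H : Finset ℕ) (μ : (ℕ → ℕ) → K) (x : PV TVar) : LL H μ (X x ^ 2 - X x) = 0 := by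
  have : (X x ^ 2 : MvPolynomial (PV TVar) K) = monomial (Finsupp.single x 2) 1 := by
    rw [X_pow_eq_monomial]
  rw [map_sub, this, LL_monomial, LL_X]
  have h2 : val K (Finsupp.single x 2) = fun f => pt K f x := by
    ext f; simp [val, pt_sq]
  rw [h2, pig, (Finsupp.support_single (a := x) (b := 2) two_ne_zero)]
  simp

lemma LL_compl (H0 : 0 ∉ H) {μ : (ℕ → ℕ) → K} {v : TVar} (hc : Cons H μ {v.pigeon}) :
    LL H μ (1 - X (v, false) - X (v, true)) = 0 := by
  have h := EE_insert (μ := μ) (v := v.pigeon) (T := ∅) H0 (by simp) (by simpa using hc) (fun _ => 1) (by simp)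
  have h1 : LL H μ 1 = EE H μ ∅ (fun _ => 1) := by
    rw [LL_one]; simp [EE, finsupp_empty]
  rw [map_sub, map_sub, h1, ← h, LL_X, LL_X]
  rw [insert_empty_eq]
  simp only [EE]
  rw [← Finset.sum_sub_distrib, ← Finset.sum_sub_distrib]
  apply Finset.sum_eq_zero
  intro f _
  simp [pt]
  ring

lemma pig_add (m : PV TVar →₀ ℕ) (x : PV TVar) :
    pig (Finsupp.single x 1 + m) = insert x.1.pigeon (pig m) := by
  classical
  ext w
  simp only [pig, Finset.mem_image, Finset.mem_insert, Finsupp.mem_support_iff, Finsupp.add_apply]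
  constructor
  · rintro ⟨y, hy, rfl⟩
    by_cases hyx : y = x
    · left; rw [hyx]
    · right; refine ⟨y, ?_, rfl⟩
      simpa [Finsupp.single_apply, Ne.symm hyx] using hy
  · rintro (h | ⟨y, hy, rfl⟩)
    · exact ⟨x, by simp, h.symm⟩
    · exact ⟨y, by omega, rfl⟩

lemma val_add (m : PV TVar →₀ ℕ) (x : PV TVar) (f : ℕ → ℕ) :
    val K (Finsupp.single x 1 + m) f = pt K f x * val K m f := by
  classical
  rw [val, Finsupp.prod_add_index' (by simp) (by intros; rw [pow_add])]
  simp [val]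

lemma val_congr (m : PV TVar →₀ ℕ) {f g : ℕ → ℕ} (h : ∀ v ∈ pig m, f v = g v) :
    val K m f = val K m g := by
  apply Finsupp.prod_congr
  intro x hx
  rw [pt_eq, pt_eq, h]
  exact Finset.mem_image_of_mem _ hx

lemma LL_mul (H0 : 0 ∉ H) {r : ℕ} (hr : 2 * r - 1 ≤ H.card) {μ : (ℕ → ℕ) → K}
    (hv : ∀ f, μ f ≠ 0 → Val H f) (hc : ∀ S : Finset ℕ, S.card ≤ r → Cons H μ S)
    (x : PV TVar) :
    ∃ μ' : (ℕ → ℕ) → K, (∀ f, μ' f ≠ 0 → Val H f) ∧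
      (∀ S : Finset ℕ, S.card ≤ r → Cons H μ' S) ∧
      (∀ p : MvPolynomial (PV TVar) K, (∀ m ∈ (X x * p).support, monoPigeonDegree m ≤ r) →
        LL H μ' p = LL H μ (X x * p)) := by
  classical
  obtain ⟨μ', g1, g2, g3, g4⟩ := mul_cons H0 r hr μ hv hc x.1.pigeon (loc K x)
  refine ⟨μ', g1, g2, ?_⟩
  intro p hp
  rw [p.as_sum, Finset.mul_sum, map_sum, map_sum]
  refine Finset.sum_congr rfl fun m hm => ?_
  have hX : (X x : MvPolynomial (PV TVar) K) = monomial (Finsupp.single x 1) 1 := rfl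
  have hd : (insert x.1.pigeon (pig m)).card ≤ r := by
    rw [← pig_add]
    apply hp
    rw [mem_support_iff] at hm ⊢
    rwa [coeff_X_mul]
  rw [hX, monomial_mul, one_mul, LL_monomial, LL_monomial, pig_add]
  congr 1
  by_cases hvm : x.1.pigeon ∈ pig m
  · rw [Finset.insert_eq_of_mem hvm] at hd ⊢
    refine Finset.sum_congr rfl fun f hf => ?_
    rw [g3 _ _ (dom_of_mem H0 hf) hvm hd, val_add, pt_eq]
    ring
  · rw [EE, EE, sum_insert_finsupp H0 hvm (fun f => μ f * val K (Finsupp.single x 1 + m) f)]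
    rw [Finset.card_insert_of_notMem hvm] at hd
    refine Finset.sum_congr rfl fun f hf => ?_
    rw [g4 _ _ (dom_of_mem H0 hf) hvm (by omega), Finset.sum_mul]
    refine Finset.sum_congr rfl fun h _ => ?_
    rw [val_add, pt_eq, update_self, val_congr (K := K) m (f := update (f : ℕ → ℕ) x.1.pigeon h)
      (g := f)]
    · ring
    · intro w hw
      rw [update_of_ne]
      intro h'; exact hvm (h' ▸ hw)

lemma encode_eq (C : Clause TVar) :
    encodeClauseMono K C = monomial (∑ l ∈ C, Finsupp.single (l.1, !l.2) 1) 1 := by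
  rw [encodeClauseMono, monomial_sum_one]
  rfl

lemma val_clause (C : Clause TVar) (f : ℕ → ℕ) :
    val K (∑ l ∈ C, Finsupp.single (l.1, !l.2) 1) f = ∏ l ∈ C, pt K f (l.1, !l.2) := by
  classical
  induction C using Finset.induction_on with
  | empty => simp [val]
  | insert a s ha ih => rw [Finset.sum_insert ha, Finset.prod_insert ha, val_add, ih]

lemma mem_pig_clause (C : Clause TVar) (l : TVar × Bool) (hl : l ∈ C) :
    l.1.pigeon ∈ pig (∑ l ∈ C, Finsupp.single (l.1, !l.2) 1) := by
  classical
  rw [← Finset.add_sum_erase _ _ hl, pig_add]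
  simp

lemma LL_clause {k : ℕ} (hk : 4 ≤ k) {μ : (ℕ → ℕ) → K}
    (hv : ∀ f, μ f ≠ 0 → Val (Finset.Icc 1 (k - 1)) f) {C : Clause TVar} (hC : C ∈ TPHP k) :
    LL (Finset.Icc 1 (k - 1)) μ (encodeClauseMono K C) = 0 := by
  classical
  rw [encode_eq, LL_monomial, one_mul]
  apply Finset.sum_eq_zero
  intro f hf
  rw [val_clause]
  have hf2 : ∀ l ∈ C, 1 ≤ f l.1.pigeon ∧ f l.1.pigeon ≤ k - 1 := by
    intro l hl
    rw [Finset.mem_finsupp_iff] at hf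
    simpa using hf.2 _ (mem_pig_clause C l hl)
  have prod0 : ∀ l ∈ C, pt K f (l.1, !l.2) = 0 →
      μ f * ∏ l ∈ C, pt K f (l.1, !l.2) = 0 := by
    intro l hl h
    rw [Finset.prod_eq_zero hl h, mul_zero]
  rcases hC with ⟨v, _, _, rfl⟩ | ⟨v, w, _, _, _, _, rfl⟩ | ⟨v, _, _, rfl⟩ |
    ⟨v, v', w, _, _, _, _, hne, hw, _, rfl⟩
  · have := hf2 (TVar.q v 1, true) (by simp)
    simp only [TVar.pigeon] at this
    by_cases h : f v = 1
    · exact prod0 (TVar.q v 1, true) (by simp) (by simp [pt, base, h])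
    · exact prod0 (TVar.z v 1, true) (by simp) (by simp [pt, base]; omega)
  · by_cases h : w < f v
    · by_cases h' : f v = w + 1
      · exact prod0 (TVar.q v (w+1), true) (by simp) (by simp [pt, base, h'])
      · exact prod0 (TVar.z v (w+1), true) (by simp) (by simp [pt, base]; omega)
    · exact prod0 (TVar.z v w, false) (by simp) (by simp [pt, base, h])
  · have := hf2 (TVar.q v (k-2), true) (by simp)
    simp only [TVar.pigeon] at this
    by_cases h : f v = k - 2
    · exact prod0 (TVar.q v (k-2), true) (by simp) (by simp [pt, base, h])
    · by_cases h' : f v = k - 1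
      · exact prod0 (TVar.q v (k-1), true) (by simp) (by simp [pt, base, h'])
      · exact prod0 (TVar.z v (k-3), false) (by simp) (by
          have h3 : ¬ (k - 3 < f v) := by omega
          simp [pt, base, h3])
  · by_cases h : f v = w
    · by_cases h' : f v' = w
      · have : μ f = 0 := by
          by_contra hmu
          exact hne ((hv _ hmu).2 v v' (by omega) (by omega))
        rw [this, zero_mul]
      · exact prod0 (TVar.q v' w, false) (by simp) (by simp [pt, base, h'])
    · exact prod0 (TVar.q v w, false) (by simp) (by simp [pt, base, h])

end Aux

/-- for every `k ≥ 4` and every field `K`, every PCR refutation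
of `TPHP` over `K` has pigeon-degree at least `⌈(k−1)/2⌉`, i.e., it contains
a monomial mentioning at least `⌈(k−1)/2⌉` pigeons.  (Note that
`⌈(k−1)/2⌉ = ((k−1)+1)/2` with natural-number division.) -/
theorem pcr_pigeon_degree_lower_bound (K : Type) [Field K] (k : ℕ) (hk : 4 ≤ k)
    (π : PCRRefutation K TVar (TPHP k)) :
    ∃ p ∈ π.lines, ∃ m ∈ p.support, ((k - 1) + 1) / 2 ≤ monoPigeonDegree m := by
  by_contra hcon
  push Not at hcon
  obtain ⟨r, hr⟩ : ∃ r, (k - 1 + 1) / 2 = r + 1 := ⟨(k - 1 + 1) / 2 - 1, by omega⟩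
  have hr1 : 1 ≤ r := by omega
  have H0 : (0 : ℕ) ∉ Finset.Icc 1 (k - 1) := by simp
  have hcard : 2 * r - 1 ≤ (Finset.Icc 1 (k - 1)).card := by simp; omega
  have hdeg : ∀ p ∈ π.lines, ∀ m ∈ p.support, monoPigeonDegree m ≤ r := by
    intro p hp m hm
    have := hcon p hp m hm
    omega
  have key : ∀ (t : ℕ) (p : MvPolynomial (PV TVar) K), π.lines[t]? = some p →
      ∀ μ : (ℕ → ℕ) → K, (∀ f, μ f ≠ 0 → Aux.Val (Finset.Icc 1 (k - 1)) f) →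
      (∀ S : Finset ℕ, S.card ≤ r → Aux.Cons (Finset.Icc 1 (k - 1)) μ S) →
      Aux.LL (Finset.Icc 1 (k - 1)) μ p = 0 := by
    intro t
    induction t using Nat.strong_induction_on with
    | _ t ih =>
    intro p hp μ hv hc
    rcases π.valid t p hp with ⟨x, rfl⟩ | ⟨v, rfl⟩ | ⟨C, hC, rfl⟩ |
      ⟨i, j, hi, hj, a, b, p1, p2, h1, h2, rfl⟩ | ⟨i, hi, x, p1, h1, rfl⟩
    · exact Aux.LL_bool _ _ _
    · exact Aux.LL_compl H0 (hc _ (by simpa using hr1))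
    · exact Aux.LL_clause hk hv hC
    · rw [map_add, map_smul, map_smul, ih i hi p1 h1 μ hv hc, ih j hj p2 h2 μ hv hc]
      simp
    · obtain ⟨μ', g1, g2, g3⟩ := Aux.LL_mul H0 hcard hv hc x
      rw [← g3 p1 (hdeg _ (List.mem_of_getElem? hp))]
      exact ih i hi p1 h1 μ' g1 g2
  obtain ⟨μ, h1, h2, h3⟩ := Aux.exists_cons K (Finset.Icc 1 (k - 1)) H0 r hcard
  have h1' : π.lines[π.lines.length - 1]? = some 1 := by
    rw [← π.last_one, List.getLast_eq_getElem]
    exact List.getElem?_eq_getElem _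
  have := key _ _ h1' μ h1 h2
  rw [Aux.LL_one, h3] at this
  exact one_ne_zero this

end NarrowProofs
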